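/- arXiv:2502.03180 — 2 statements merged into one kernel-verified Lean document; each statement's English description precedes it below -/
import Mathlib

section
/- Every word w in the free group F(x₁,x₂,y₁,y₂) that maps to the trivial element of the Bridson–Dison group K (under xᵢ ↦ aᵢcᵢ⁻¹, yᵢ ↦ bᵢcᵢ⁻¹ in F₂ × F₂ × F₂) lies in the commutator subgroup of F(x₁,x₂,y₁,y₂). -/
/-- The free group of rank 2. -/
abbrev F2 := FreeGroup (Fin 2)

/-- The direct product of three free groups of rank 2. -/
abbrev G3 := F2 × F2 × F2

/-- `ℤ²`, written multiplicatively. -/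
abbrev Z2 := Multiplicative (Fin 2 → ℤ)

/-- The `i`-th standard basis vector of `ℤ²`. -/
def e (i : Fin 2) : Z2 := Multiplicative.ofAdd (Pi.single i 1)

/-- The homomorphism `F₂ → ℤ²` sending the `i`-th generator to `eᵢ`. -/
def φ : F2 →* Z2 := FreeGroup.lift e

/-- Projection to the first factor. -/
def pa : G3 →* F2 := MonoidHom.fst _ _
/-- Projection to the second factor. -/
def pb : G3 →* F2 := (MonoidHom.fst _ _).comp (MonoidHom.snd _ _)
/-- Projection to the third factor. -/
def pc : G3 →* F2 := (MonoidHom.snd F2 F2).comp (MonoidHom.snd _ _)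

/-- The homomorphism `ψ : F₂ × F₂ × F₂ → ℤ²` with `ψ(aᵢ) = ψ(bᵢ) = ψ(cᵢ) = eᵢ`. -/
def ψ : G3 →* Z2 := (φ.comp pa) * (φ.comp pb) * (φ.comp pc)

/-- The generators `aᵢ` of the first factor, inside the product. -/
def a (i : Fin 2) : G3 := (FreeGroup.of i, 1, 1)
/-- The generators `bᵢ` of the second factor, inside the product. -/
def b (i : Fin 2) : G3 := (1, FreeGroup.of i, 1)
/-- The generators `cᵢ` of the third factor, inside the product. -/
def c (i : Fin 2) : G3 := (1, 1, FreeGroup.of i)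

/-- `xᵢ = aᵢ cᵢ⁻¹`. -/
def x (i : Fin 2) : G3 := a i * (c i)⁻¹
/-- `yᵢ = bᵢ cᵢ⁻¹`. -/
def y (i : Fin 2) : G3 := b i * (c i)⁻¹

/-- The alphabet `{x₁, x₂, y₁, y₂}`. -/
abbrev S4 := Fin 2 ⊕ Fin 2

/-- The evaluation map `F(x₁,x₂,y₁,y₂) → F₂ × F₂ × F₂`, `xᵢ ↦ aᵢcᵢ⁻¹`, `yᵢ ↦ bᵢcᵢ⁻¹`. -/
def ev : FreeGroup S4 →* G3 := FreeGroup.lift (Sum.elim x y)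

/-- Every word in `F(x₁,x₂,y₁,y₂)` representing the trivial element of the Bridson–Dison
group lies in the commutator subgroup of `F(x₁,x₂,y₁,y₂)`. -/
theorem trivial_words_in_commutator (w : FreeGroup S4) (hw : ev w = 1) :
    w ∈ commutator (FreeGroup S4) := by
  -- A homomorphism `G3 → (FreeGroup S4)ᵃᵇ` whose composite with `ev` is the abelianization map.
  let A := Abelianization (FreeGroup S4)
  let f : F2 →* A := FreeGroup.lift fun i => Abelianization.of (FreeGroup.of (Sum.inl i))
  let g : F2 →* A := FreeGroup.lift fun i => Abelianization.of (FreeGroup.of (Sum.inr i))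
  let r : G3 →* A := f.comp pa * g.comp pb
  have h : r.comp ev = Abelianization.of := by
    ext s
    rcases s with i | i <;> simp [r, f, g, ev, pa, pb, x, y, a, b, c]
  have h2 : Abelianization.of w = 1 := by
    rw [← h, MonoidHom.comp_apply, hw, map_one]
  rw [← Abelianization.ker_of]
  exact h2
end

section
/- Let g be an element of K = ker(ψ : F_r^{(1)} × ⋯ × F_r^{(n)} → ℤ^r) with n ≥ r+2, and for i ∈ {1,…,n} let gᵢ ∈ F_r^{(i)} be the projection of g to the i-th factor. Then the element g_n(Δ⁻¹) · (g₁(Δ) ⋯ g_{n−1}(Δ))⁻¹ of the free group on Δ = (x_1^{(1)},…,x_r^{(r)}) lies in the commutator subgroup of F(Δ). -/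
section
variable (n r : ℕ)

/-- The direct product of `n` copies of the free group of rank `r`. -/
abbrev Gnr := Fin n → FreeGroup (Fin r)

/-- `ℤ^r`, written multiplicatively. -/
abbrev Zr (r : ℕ) := Multiplicative (Fin r → ℤ)

/-- The homomorphism `F_r → ℤ^r` sending the `j`-th generator to the `j`-th basis vector. -/
def φr : FreeGroup (Fin r) →* Zr r :=
  FreeGroup.lift (fun j => Multiplicative.ofAdd (Pi.single j 1))

/-- The homomorphism `ψ : F_r^{(1)} × ⋯ × F_r^{(n)} → ℤ^r` with `ψ(a_j^{(α)}) = e_j`. -/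
def ψnr : Gnr n r →* Zr r :=
  ∏ α : Fin n, (φr r).comp (Pi.evalMonoidHom (fun _ => FreeGroup (Fin r)) α)

variable {n} in
/-- The inclusion of the `α`-th factor into the direct product. -/
def ins (α : Fin n) : FreeGroup (Fin r) →* Gnr n r :=
  MonoidHom.mulSingle (fun _ => FreeGroup (Fin r)) α

end

/-- The last index, corresponding to the `n`-th factor. -/
def lastIdx {n : ℕ} (hn : 0 < n) : Fin n := ⟨n - 1, by omega⟩

/-- The generators `x_j^{(α)} = a_j^{(α)} (a_j^{(n)})⁻¹` of the kernel. -/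
def xg {n r : ℕ} (hn : 0 < n) (α : Fin n) (j : Fin r) : Gnr n r :=
  ins r α (FreeGroup.of j) * (ins r (lastIdx hn) (FreeGroup.of j))⁻¹

/-- Substituting each letter by its inverse: the endomorphism of `F(Δ)` sending each basis
element `δⱼ` to `δⱼ⁻¹` (i.e. `w ↦ w(Δ⁻¹)` regarded in `F(Δ)`). -/
def invSub (r : ℕ) : FreeGroup (Fin r) →* FreeGroup (Fin r) :=
  FreeGroup.lift (fun j => (FreeGroup.of j)⁻¹)

theorem phi_ker_le_commutator (r : ℕ) (w : FreeGroup (Fin r)) (hw : φr r w = 1) :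
    w ∈ commutator (FreeGroup (Fin r)) := by
  let ρ : Zr r →* Abelianization (FreeGroup (Fin r)) :=
    { toFun := fun x => ∏ j, Abelianization.of (FreeGroup.of j) ^ (Multiplicative.toAdd x j)
      map_one' := by simp
      map_mul' := by
        intro x y
        simp [zpow_add, Finset.prod_mul_distrib] }
  have hρ : ρ.comp (φr r) = Abelianization.of := by
    apply FreeGroup.ext_hom
    intro j
    change ρ (φr r (FreeGroup.of j)) = _
    rw [φr, FreeGroup.lift_apply_of]
    change ∏ k, Abelianization.of (FreeGroup.of k) ^ ((Pi.single j 1 : Fin r → ℤ) k) = _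
    rw [Finset.prod_eq_single j]
    · simp
    · intro b _ hb
      simp [Pi.single_eq_of_ne hb]
    · simp
  have h : Abelianization.of w = 1 := by
    rw [← hρ, MonoidHom.comp_apply, hw, map_one]
  rw [← Abelianization.ker_of]
  exact h

theorem phi_invSub (r : ℕ) (w : FreeGroup (Fin r)) : φr r (invSub r w) = (φr r w)⁻¹ := by
  have h : (φr r).comp (invSub r) = (φr r)⁻¹ := by
    apply FreeGroup.ext_hom
    intro j
    simp [invSub]
  exact DFunLike.congr_fun h w

/-- For `g ∈ K` with projections `gᵢ` to the factors, the element
`g_n(Δ⁻¹) · (g₁(Δ) ⋯ g_{n−1}(Δ))⁻¹` of the free group on `Δ` lies in its commutator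
subgroup.  (Here the free group on `Δ = (x_1^{(1)},…,x_r^{(r)})` is identified with the
free group of rank `r`, `g_i(Δ)` is `g_i` read in the letters `Δ`, and `g_n(Δ⁻¹)` is `g_n`
with each letter replaced by the inverse of the corresponding letter of `Δ`.) -/
theorem diagonal_part_in_commutator (n r : ℕ) (hrn : r + 2 ≤ n)
    (g : Gnr n r) (hg : g ∈ (ψnr n r).ker) :
    invSub r (g (lastIdx (by omega))) *
        ((List.ofFn (fun i : Fin (n - 1) => g ⟨i.1, by omega⟩)).prod)⁻¹ ∈
      commutator (FreeGroup (Fin r)) := by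
  obtain ⟨m, rfl⟩ : ∃ m, n = m + 1 := ⟨n - 1, by omega⟩
  apply phi_ker_le_commutator
  have h1 : ψnr (m + 1) r g = 1 := hg
  simp only [ψnr, MonoidHom.finsetProd_apply, MonoidHom.comp_apply,
    Pi.evalMonoidHom_apply] at h1
  rw [Fin.prod_univ_castSucc] at h1
  rw [map_mul, phi_invSub, map_inv, map_list_prod, List.map_ofFn, List.prod_ofFn, ← mul_inv,
    inv_eq_one, mul_comm]
  exact h1
end
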